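/- Assume there is ε ∈ (0,1) with ‖K* − K̄‖_F ≤ (ε/2)·√(λ_min(Γ)) / (√(λ_min(Γ))·‖S B_a‖_F + ‖S B_u‖_F). Then for every Λ ∈ S₀ the Loewner-order inequality (A+B_uΛ+B_aK_u(Λ))ᵀS + S(A+B_uΛ+B_aK_u(Λ)) ≼ −2(1−ε)I holds; in particular A+B_uΛ+B_aK_u(Λ) is Hurwitz uniformly over S₀, i.e., the supremum over Λ ∈ S₀ of the spectral abscissa (the maximum real part of the complex eigenvalues) of A+B_uΛ+B_aK_u(Λ) is strictly negative. -/

import Mathlib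

open Matrix Filter Topology

noncomputable section

/-- A real square matrix is Hurwitz if every complex eigenvalue has strictly
negative real part. -/
def IsHurwitz {N : ℕ} (M : Matrix (Fin N) (Fin N) ℝ) : Prop :=
  ∀ μ : ℂ, μ ∈ spectrum ℂ (M.map (algebraMap ℝ ℂ)) → μ.re < 0

/-- Frobenius norm of a real matrix. -/
def frobNorm {p q : ℕ} (M : Matrix (Fin p) (Fin q) ℝ) : ℝ :=
  Real.sqrt (Matrix.trace (Mᵀ * M))

/-- Minimal eigenvalue of a (Hermitian) real matrix. -/
def eigMin {m : ℕ} (M : Matrix (Fin m) (Fin m) ℝ) : ℝ :=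
  if hM : M.IsHermitian then ⨅ i, hM.eigenvalues i else 0

/-- Maximal eigenvalue of a (Hermitian) real matrix. -/
def eigMax {m : ℕ} (M : Matrix (Fin m) (Fin m) ℝ) : ℝ :=
  if hM : M.IsHermitian then ⨆ i, hM.eigenvalues i else 0

variable {n m_u m_a : ℕ}

/-- `P` is the stabilizing solution of the spoofed ARE for the gain `Λ`. -/
def IsStabSol (A : Matrix (Fin n) (Fin n) ℝ) (Bu : Matrix (Fin n) (Fin m_u) ℝ)
    (Ba : Matrix (Fin n) (Fin m_a) ℝ) (Q : Matrix (Fin n) (Fin n) ℝ)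
    (R : Matrix (Fin m_a) (Fin m_a) ℝ)
    (Λ : Matrix (Fin m_u) (Fin n) ℝ) (P : Matrix (Fin n) (Fin n) ℝ) : Prop :=
  P.PosDef ∧
  (A + Bu * Λ)ᵀ * P + P * (A + Bu * Λ) + Q + P * Ba * R⁻¹ * Baᵀ * P = 0 ∧
  IsHurwitz (A + Bu * Λ + Ba * R⁻¹ * Baᵀ * P)

/-- `Pim` is a symmetric solution of the Lyapunov equation defining `Π(Λ)`,
given the stabilizing ARE solution `P = P_u(Λ)`. -/
def IsLyapSol (A : Matrix (Fin n) (Fin n) ℝ) (Bu : Matrix (Fin n) (Fin m_u) ℝ)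
    (Ba : Matrix (Fin n) (Fin m_a) ℝ) (R : Matrix (Fin m_a) (Fin m_a) ℝ)
    (Kbar : Matrix (Fin m_a) (Fin n) ℝ)
    (Λ : Matrix (Fin m_u) (Fin n) ℝ) (P Pim : Matrix (Fin n) (Fin n) ℝ) : Prop :=
  Pim.IsHermitian ∧
  (A + Bu * Λ + Ba * R⁻¹ * Baᵀ * P) * Pim + Pim * (A + Bu * Λ + Ba * R⁻¹ * Baᵀ * P)ᵀ
    - Kbarᵀ * R⁻¹ * Baᵀ - Ba * R⁻¹ * Kbar
    + P * Ba * (R⁻¹ * R⁻¹) * Baᵀ + Ba * (R⁻¹ * R⁻¹) * Baᵀ * P = 0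

/-- The deception cost `J̃(Λ)`, expressed through a choice function `Pu` for the
stabilizing solution of the spoofed ARE. -/
def Jcost (Ba : Matrix (Fin n) (Fin m_a) ℝ) (R : Matrix (Fin m_a) (Fin m_a) ℝ)
    (Γ : Matrix (Fin m_u) (Fin m_u) ℝ) (Kbar : Matrix (Fin m_a) (Fin n) ℝ)
    (Pu : Matrix (Fin m_u) (Fin n) ℝ → Matrix (Fin n) (Fin n) ℝ)
    (Λ : Matrix (Fin m_u) (Fin n) ℝ) : ℝ :=
  frobNorm (R⁻¹ * Baᵀ * Pu Λ - Kbar) ^ 2 + Matrix.trace (Λᵀ * Γ * Λ)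

/-- The sublevel set `S₀`. -/
def S0 (A : Matrix (Fin n) (Fin n) ℝ) (Bu : Matrix (Fin n) (Fin m_u) ℝ)
    (Ba : Matrix (Fin n) (Fin m_a) ℝ) (Q : Matrix (Fin n) (Fin n) ℝ)
    (R : Matrix (Fin m_a) (Fin m_a) ℝ) (Γ : Matrix (Fin m_u) (Fin m_u) ℝ)
    (Kbar : Matrix (Fin m_a) (Fin n) ℝ)
    (Pu : Matrix (Fin m_u) (Fin n) ℝ → Matrix (Fin n) (Fin n) ℝ) :
    Set (Matrix (Fin m_u) (Fin n) ℝ) :=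
  {Λ | (∃ P, IsStabSol A Bu Ba Q R Λ P) ∧
    Jcost Ba R Γ Kbar Pu Λ ≤ Jcost Ba R Γ Kbar Pu 0}

section Frobenius

open scoped Matrix.Norms.Frobenius

theorem frobNorm_eq_norm {p q : ℕ} (M : Matrix (Fin p) (Fin q) ℝ) : frobNorm M = ‖M‖ := by
  rw [frobenius_norm_def, frobNorm, Real.sqrt_eq_rpow, Finset.sum_comm]
  congr 1
  simp only [Matrix.trace, Matrix.diag, Matrix.mul_apply, Matrix.transpose_apply, Real.rpow_two,
    Real.norm_eq_abs, sq_abs]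
  simp only [sq]

theorem frobNorm_nonneg {p q : ℕ} (M : Matrix (Fin p) (Fin q) ℝ) : 0 ≤ frobNorm M :=
  Real.sqrt_nonneg _

theorem frobNorm_sq {p q : ℕ} (M : Matrix (Fin p) (Fin q) ℝ) :
    frobNorm M ^ 2 = Matrix.trace (Mᵀ * M) := by
  refine Real.sq_sqrt ?_
  simpa using (Matrix.posSemidef_conjTranspose_mul_self M).trace_nonneg

theorem frobNorm_add_le {p q : ℕ} (M N : Matrix (Fin p) (Fin q) ℝ) :
    frobNorm (M + N) ≤ frobNorm M + frobNorm N := by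
  simpa only [frobNorm_eq_norm] using norm_add_le M N

theorem frobNorm_sub_le {p q : ℕ} (M N : Matrix (Fin p) (Fin q) ℝ) :
    frobNorm (M - N) ≤ frobNorm M + frobNorm N := by
  simpa only [frobNorm_eq_norm] using norm_sub_le M N

theorem frobNorm_mul_le {p q r : ℕ} (M : Matrix (Fin p) (Fin q) ℝ)
    (N : Matrix (Fin q) (Fin r) ℝ) : frobNorm (M * N) ≤ frobNorm M * frobNorm N := by
  simpa only [frobNorm_eq_norm] using frobenius_norm_mul M N

end Frobenius

/-- A quadratic form is bounded by the Frobenius norm of its matrix. -/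
theorem dotProduct_mulVec_le_frobNorm {p : ℕ} (M : Matrix (Fin p) (Fin p) ℝ) (x : Fin p → ℝ) :
    x ⬝ᵥ (M *ᵥ x) ≤ frobNorm M * (x ⬝ᵥ x) := by
  have hx : 0 ≤ x ⬝ᵥ x := by simpa using dotProduct_star_self_nonneg x
  refine abs_le_of_sq_le_sq' ?_ (mul_nonneg (frobNorm_nonneg M) hx) |>.2
  have h := Finset.sum_mul_sq_le_sq_mul_sq (Finset.univ : Finset (Fin p × Fin p))
    (fun k => M k.1 k.2) (fun k => x k.1 * x k.2)
  have h1 : x ⬝ᵥ (M *ᵥ x) = ∑ k : Fin p × Fin p, M k.1 k.2 * (x k.1 * x k.2) := by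
    simp only [dotProduct, mulVec, Finset.mul_sum, Fintype.sum_prod_type]
    exact Finset.sum_congr rfl fun i _ => Finset.sum_congr rfl fun j _ => by ring
  have h2 : ∑ k : Fin p × Fin p, M k.1 k.2 ^ 2 = frobNorm M ^ 2 := by
    rw [frobNorm_sq, Fintype.sum_prod_type, Finset.sum_comm]
    simp only [Matrix.trace, Matrix.diag, Matrix.mul_apply, Matrix.transpose_apply, sq]
  have h3 : ∑ k : Fin p × Fin p, (x k.1 * x k.2) ^ 2 = (x ⬝ᵥ x) ^ 2 := by
    simp only [dotProduct, sq, Fintype.sum_prod_type, Finset.sum_mul_sum]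
    exact Finset.sum_congr rfl fun i _ => Finset.sum_congr rfl fun j _ => by ring
  rw [mul_pow, h1, ← h2, ← h3]
  exact h

theorem posSemidef_smul_one_sub_of_frobNorm_le {p : ℕ} {X : Matrix (Fin p) (Fin p) ℝ} {δ : ℝ}
    (hX : frobNorm X ≤ δ) :
    ((2 * δ) • (1 : Matrix (Fin p) (Fin p) ℝ) - (Xᵀ + X)).PosSemidef := by
  refine .of_dotProduct_mulVec_nonneg ?_ fun x => ?_
  · ext i j
    simp [Matrix.one_apply, eq_comm, add_comm]
  · have hx : 0 ≤ x ⬝ᵥ x := by simpa using dotProduct_star_self_nonneg x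
    have h := dotProduct_mulVec_le_frobNorm X x
    have ht : x ⬝ᵥ (Xᵀ *ᵥ x) = x ⬝ᵥ (X *ᵥ x) := by
      rw [mulVec_transpose, dotProduct_comm, ← dotProduct_mulVec]
    simp only [star_trivial, sub_mulVec, add_mulVec, smul_mulVec, one_mulVec, dotProduct_sub,
      dotProduct_add, dotProduct_smul, smul_eq_mul, ht]
    nlinarith [mul_le_mul_of_nonneg_right hX hx]

theorem posSemidef_sub_eigMin_smul_one {m : ℕ} {M : Matrix (Fin m) (Fin m) ℝ}
    (hM : M.IsHermitian) : (M - eigMin M • (1 : Matrix (Fin m) (Fin m) ℝ)).PosSemidef := by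
  rw [posSemidef_iff_isHermitian_and_spectrum_nonneg]
  refine ⟨hM.sub (by ext i j; simp [Matrix.one_apply, eq_comm]), fun x hx => ?_⟩
  rw [← Algebra.algebraMap_eq_smul_one, ← spectrum.sub_singleton_eq,
    hM.spectrum_real_eq_range_eigenvalues] at hx
  obtain ⟨_, ⟨i, rfl⟩, _, rfl, rfl⟩ := hx
  simp only [Set.mem_ofPred_eq, eigMin, dif_pos hM, sub_nonneg]
  exact ciInf_le (Set.finite_range _).bddBelow i

theorem eigMin_mul_frobNorm_sq_le {m k : ℕ} {M : Matrix (Fin m) (Fin m) ℝ}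
    (hM : M.IsHermitian) (L : Matrix (Fin m) (Fin k) ℝ) :
    eigMin M * frobNorm L ^ 2 ≤ Matrix.trace (Lᵀ * M * L) := by
  have h := ((posSemidef_sub_eigMin_smul_one hM).conjTranspose_mul_mul_same L).trace_nonneg
  rw [conjTranspose_eq_transpose_of_trivial] at h
  simpa [Matrix.mul_sub, Matrix.sub_mul, ← frobNorm_sq] using h

theorem eigMin_pos {m : ℕ} [Nonempty (Fin m)] {M : Matrix (Fin m) (Fin m) ℝ}
    (hM : M.PosDef) : 0 < eigMin M := by
  rw [eigMin, dif_pos hM.isHermitian]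
  obtain ⟨i, hi⟩ := exists_eq_ciInf_of_finite (f := hM.isHermitian.eigenvalues)
  rw [← hi]
  exact hM.eigenvalues_pos i

theorem frobNorm_eq_zero_of_isEmpty {m k : ℕ} [IsEmpty (Fin m)] (L : Matrix (Fin m) (Fin k) ℝ) :
    frobNorm L = 0 := by
  simp [frobNorm, Subsingleton.elim L 0]

/-- The real and imaginary parts of a complex eigenvector of a real matrix. -/
theorem exists_real_imag_eigenvector {p : ℕ} {M : Matrix (Fin p) (Fin p) ℝ} {μ : ℂ}
    (hμ : μ ∈ spectrum ℂ (M.map (algebraMap ℝ ℂ))) :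
    ∃ a b : Fin p → ℝ, (a ≠ 0 ∨ b ≠ 0) ∧
      M *ᵥ a = μ.re • a - μ.im • b ∧ M *ᵥ b = μ.im • a + μ.re • b := by
  rw [← Matrix.spectrum_toLin', ← Module.End.hasEigenvalue_iff_mem_spectrum] at hμ
  obtain ⟨v, hv⟩ := hμ.exists_hasEigenvector
  have hMv := hv.apply_eq_smul
  rw [Matrix.toLin'_apply] at hMv
  refine ⟨fun i => (v i).re, fun i => (v i).im, ?_, ?_, ?_⟩
  · by_contra! h
    exact hv.2 (funext fun i => Complex.ext (congrFun h.1 i) (congrFun h.2 i))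
  · ext i
    have := congrArg Complex.re (congrFun hMv i)
    simpa [mulVec, dotProduct] using this
  · ext i
    have := congrArg Complex.im (congrFun hMv i)
    simpa [mulVec, dotProduct, add_comm] using this

/-- A strict Lyapunov inequality bounds the spectral abscissa. -/
theorem re_le_of_lyapunov {p : ℕ} {M S : Matrix (Fin p) (Fin p) ℝ} {δ : ℝ} (hδ : 0 ≤ δ)
    (hS : S.PosDef)
    (hM : ((-(2 * δ)) • (1 : Matrix (Fin p) (Fin p) ℝ) - (Mᵀ * S + S * M)).PosSemidef)
    {μ : ℂ} (hμ : μ ∈ spectrum ℂ (M.map (algebraMap ℝ ℂ))) :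
    μ.re ≤ -(δ / (frobNorm S + 1)) := by
  obtain ⟨a, b, hab, ha, hb⟩ := exists_real_imag_eigenvector hμ
  have hST : Sᵀ = S := by simpa using hS.isHermitian.eq
  have key (x : Fin p → ℝ) : 2 * ((M *ᵥ x) ⬝ᵥ (S *ᵥ x)) ≤ -(2 * δ) * (x ⬝ᵥ x) := by
    have h := hM.dotProduct_mulVec_nonneg x
    have e1 : x ⬝ᵥ ((Mᵀ * S) *ᵥ x) = (M *ᵥ x) ⬝ᵥ (S *ᵥ x) := by
      rw [← mulVec_mulVec, dotProduct_mulVec, vecMul_transpose]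
    have e2 : x ⬝ᵥ ((S * M) *ᵥ x) = (M *ᵥ x) ⬝ᵥ (S *ᵥ x) := by
      rw [← mulVec_mulVec, dotProduct_mulVec, ← mulVec_transpose, hST, dotProduct_comm]
    simp only [star_trivial, sub_mulVec, add_mulVec, smul_mulVec, one_mulVec, dotProduct_sub,
      dotProduct_add, dotProduct_smul, smul_eq_mul, e1, e2] at h
    linarith
  have hsymm : b ⬝ᵥ (S *ᵥ a) = a ⬝ᵥ (S *ᵥ b) := by
    rw [dotProduct_mulVec, ← mulVec_transpose, hST, dotProduct_comm]
  have hka := key a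
  have hkb := key b
  rw [ha, sub_dotProduct, smul_dotProduct, smul_dotProduct, smul_eq_mul, smul_eq_mul] at hka
  rw [hb, add_dotProduct, smul_dotProduct, smul_dotProduct, smul_eq_mul, smul_eq_mul] at hkb
  have hSa := dotProduct_mulVec_le_frobNorm S a
  have hSb := dotProduct_mulVec_le_frobNorm S b
  have hpos (x : Fin p → ℝ) : 0 ≤ x ⬝ᵥ (S *ᵥ x) := by
    simpa using hS.posSemidef.dotProduct_mulVec_nonneg x
  have haa : 0 ≤ a ⬝ᵥ a := by simpa using dotProduct_star_self_nonneg a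
  have hbb : 0 ≤ b ⬝ᵥ b := by simpa using dotProduct_star_self_nonneg b
  have hs : 0 < a ⬝ᵥ (S *ᵥ a) + b ⬝ᵥ (S *ᵥ b) := by
    rcases hab with h | h
    · exact add_pos_of_pos_of_nonneg (by simpa using hS.dotProduct_mulVec_pos h) (hpos b)
    · exact add_pos_of_nonneg_of_pos (hpos a) (by simpa using hS.dotProduct_mulVec_pos h)
  rw [hsymm] at hka
  have hF : 0 < frobNorm S + 1 := by linarith [frobNorm_nonneg S]
  refine le_of_mul_le_mul_right ?_ hs
  have ht : (a ⬝ᵥ (S *ᵥ a) + b ⬝ᵥ (S *ᵥ b)) / (frobNorm S + 1) ≤ a ⬝ᵥ a + b ⬝ᵥ b := by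
    rw [div_le_iff₀ hF]
    linarith
  have := mul_le_mul_of_nonneg_left ht hδ
  calc μ.re * (a ⬝ᵥ (S *ᵥ a) + b ⬝ᵥ (S *ᵥ b)) ≤ -(δ * (a ⬝ᵥ a + b ⬝ᵥ b)) := by linarith
    _ ≤ -(δ * ((a ⬝ᵥ (S *ᵥ a) + b ⬝ᵥ (S *ᵥ b)) / (frobNorm S + 1))) := by linarith
    _ = _ := by ring

/-- The perturbation bound: if `√l ‖Λ‖ ≤ d` and `‖K - K*‖ ≤ 2 d`, with `d` within the
admissible distance, then the perturbation of the closed loop is small. -/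
theorem perturbation_bound {l d α β L k ε : ℝ} (hl : 0 ≤ l) (hα : 0 ≤ α) (hβ : 0 ≤ β)
    (hd : 0 ≤ d) (hε : 0 ≤ ε) (hL : l * L ≤ d) (hL0 : l = 0 → L = 0) (hk : k ≤ 2 * d)
    (h : d ≤ ε / 2 * (l / (l * α + β))) : β * L + α * k ≤ ε := by
  rcases hl.eq_or_lt with rfl | hl
  · have : d = 0 := by simp at h; linarith
    subst this
    rw [hL0 rfl]
    nlinarith
  · have hD : 0 ≤ l * α + β := by positivity
    have h2 : d * (l * α + β) ≤ ε / 2 * l := by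
      rcases hD.eq_or_lt with h0 | h0
      · rw [← h0]; simp; positivity
      · rwa [← mul_div_assoc, le_div_iff₀ h0] at h
    refine le_of_mul_le_mul_left ?_ hl
    nlinarith [mul_le_mul_of_nonneg_left hL hβ,
      mul_le_mul_of_nonneg_left hk (mul_nonneg hl.le hα), mul_nonneg hβ hd]

/-- Lemma 3, item 1: uniform strict stability over `S₀`. -/
theorem stmt3
    (A : Matrix (Fin n) (Fin n) ℝ) (Bu : Matrix (Fin n) (Fin m_u) ℝ)
    (Ba : Matrix (Fin n) (Fin m_a) ℝ)
    (Q : Matrix (Fin n) (Fin n) ℝ) (R : Matrix (Fin m_a) (Fin m_a) ℝ)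
    (Γ : Matrix (Fin m_u) (Fin m_u) ℝ)
    (hQ : Q.PosDef) (hR : R.PosDef) (hΓ : Γ.PosDef)
    (Kbar : Matrix (Fin m_a) (Fin n) ℝ)
    (Pu : Matrix (Fin m_u) (Fin n) ℝ → Matrix (Fin n) (Fin n) ℝ)
    (hPu : ∀ Λ, (∃ P, IsStabSol A Bu Ba Q R Λ P) → IsStabSol A Bu Ba Q R Λ (Pu Λ))
    (h0 : ∃ P, IsStabSol A Bu Ba Q R 0 P)
    (S : Matrix (Fin n) (Fin n) ℝ) (hS : S.PosDef)
    (hSeq : (A + Ba * (R⁻¹ * Baᵀ * Pu 0))ᵀ * S + S * (A + Ba * (R⁻¹ * Baᵀ * Pu 0))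
      + (2 : ℝ) • (1 : Matrix (Fin n) (Fin n) ℝ) = 0)
    (ε : ℝ) (hε0 : 0 < ε) (hε1 : ε < 1)
    (hdist : frobNorm (R⁻¹ * Baᵀ * Pu 0 - Kbar) ≤
      (ε / 2) * (Real.sqrt (eigMin Γ) /
        (Real.sqrt (eigMin Γ) * frobNorm (S * Ba) + frobNorm (S * Bu)))) :
    (∀ Λ ∈ S0 A Bu Ba Q R Γ Kbar Pu,
      ((-(2 * (1 - ε))) • (1 : Matrix (Fin n) (Fin n) ℝ) -
        ((A + Bu * Λ + Ba * (R⁻¹ * Baᵀ * Pu Λ))ᵀ * S +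
          S * (A + Bu * Λ + Ba * (R⁻¹ * Baᵀ * Pu Λ)))).PosSemidef) ∧
    ∃ c : ℝ, c < 0 ∧ ∀ Λ ∈ S0 A Bu Ba Q R Γ Kbar Pu,
      ∀ μ : ℂ, μ ∈ spectrum ℂ
        ((A + Bu * Λ + Ba * (R⁻¹ * Baᵀ * Pu Λ)).map (algebraMap ℝ ℂ)) →
        μ.re ≤ c := by
  have hlyap : ∀ Λ ∈ S0 A Bu Ba Q R Γ Kbar Pu,
      ((-(2 * (1 - ε))) • (1 : Matrix (Fin n) (Fin n) ℝ) -
        ((A + Bu * Λ + Ba * (R⁻¹ * Baᵀ * Pu Λ))ᵀ * S +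
          S * (A + Bu * Λ + Ba * (R⁻¹ * Baᵀ * Pu Λ)))).PosSemidef := by
    rintro Λ ⟨-, hJ⟩
    simp only [Jcost, Matrix.mul_zero, Matrix.trace_zero, add_zero] at hJ
    set K := R⁻¹ * Baᵀ * Pu Λ
    set K₀ := R⁻¹ * Baᵀ * Pu 0
    have hST : Sᵀ = S := by simpa using hS.isHermitian.eq
    have hd := frobNorm_nonneg (K₀ - Kbar)
    have htr := eigMin_mul_frobNorm_sq_le hΓ.isHermitian Λ
    have hmin : 0 ≤ eigMin Γ := by
      rcases isEmpty_or_nonempty (Fin m_u) with _ | _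
      · simp [eigMin]
      · exact (eigMin_pos hΓ).le
    have hK : frobNorm (K - Kbar) ≤ frobNorm (K₀ - Kbar) :=
      abs_le_of_sq_le_sq' (by nlinarith [mul_nonneg hmin (sq_nonneg (frobNorm Λ))]) hd |>.2
    have hKK : frobNorm (K - K₀) ≤ 2 * frobNorm (K₀ - Kbar) := by
      have := frobNorm_sub_le (K - Kbar) (K₀ - Kbar)
      rw [sub_sub_sub_cancel_right] at this
      linarith
    have hΛ : √(eigMin Γ) * frobNorm Λ ≤ frobNorm (K₀ - Kbar) := by
      refine abs_le_of_sq_le_sq' ?_ hd |>.2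
      rw [mul_pow, Real.sq_sqrt hmin]
      nlinarith [sq_nonneg (frobNorm (K - Kbar))]
    have hΛ0 : √(eigMin Γ) = 0 → frobNorm Λ = 0 := by
      intro h
      rcases isEmpty_or_nonempty (Fin m_u) with _ | _
      · exact frobNorm_eq_zero_of_isEmpty Λ
      · exact absurd h (Real.sqrt_pos.2 (eigMin_pos hΓ)).ne'
    have hX : frobNorm (S * Bu * Λ + S * Ba * (K - K₀)) ≤ ε := by
      refine (frobNorm_add_le _ _).trans ((add_le_add (frobNorm_mul_le _ _)
        (frobNorm_mul_le _ _)).trans ?_)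
      exact perturbation_bound (Real.sqrt_nonneg _) (frobNorm_nonneg _) (frobNorm_nonneg _)
        hd hε0.le hΛ hΛ0 hKK hdist
    convert posSemidef_smul_one_sub_of_frobNorm_le hX using 1
    rw [← sub_eq_zero, ← neg_eq_zero, ← hSeq]
    simp only [Matrix.transpose_add, Matrix.transpose_sub, Matrix.transpose_mul, hST,
      Matrix.mul_add, Matrix.add_mul, Matrix.mul_sub, ← Matrix.mul_assoc]
    module
  refine ⟨hlyap, -((1 - ε) / (frobNorm S + 1)), ?_, fun Λ hΛ μ hμ =>
    re_le_of_lyapunov (by linarith) hS (hlyap Λ hΛ) hμ⟩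
  have := frobNorm_nonneg S
  have : 0 < 1 - ε := by linarith
  exact neg_lt_zero.2 (by positivity)
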